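/- arXiv:1512.03246 — 2 statements merged into one kernel-verified Lean document; each statement's English description precedes it below -/
import Mathlib

section
/- Let G = (V₀ ⊎ V₁, E, p) be a bipartite parity game, and let u, v ∈ V₀ be distinct nodes such that N⁺_G(v) ⊆ N⁺_G(u) and p₁(v) ≥ p₁(u). Let G' be the parity game obtained from G by deleting the edges {(w, u) ∈ E : (w, v) ∈ E}. Then the winning sets of G and G' are equal: win_i(G) = win_i(G') for i ∈ {0,1}. -/
universe u

/-- A parity game on an ambient vertex type `V`: a finite set of nodes, an owner
(player `0` or `1`) for each node, a directed edge relation between nodes, and a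
priority function. -/
structure ParityGame (V : Type u) where
  nodes : Set V
  finite : nodes.Finite
  owner : V → Fin 2
  edge : V → V → Prop
  edge_mem : ∀ u v, edge u v → u ∈ nodes ∧ v ∈ nodes
  priority : V → ℕ

namespace ParityGame

variable {V : Type u}

/-- Every node has at least one outgoing edge. -/
def Proper (G : ParityGame V) : Prop := ∀ u ∈ G.nodes, ∃ v, G.edge u v

/-- The game is bipartite: every edge goes between nodes of the two different players. -/
def Bipartite (G : ParityGame V) : Prop := ∀ u v, G.edge u v → G.owner u ≠ G.owner v

/-- The opponent `¬i = 1 - i` of player `i`. -/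
def other (i : Fin 2) : Fin 2 := 1 - i

/-- The set `V_i` of nodes owned by player `i`. -/
def playerNodes (G : ParityGame V) (i : Fin 2) : Set V := {v | v ∈ G.nodes ∧ G.owner v = i}

/-- An infinite play: consecutive positions are joined by edges. -/
def IsPlay (G : ParityGame V) (f : ℕ → V) : Prop := ∀ n, G.edge (f n) (f (n + 1))

/-- A (history-dependent) strategy: given the history of previously visited nodes and
the current node, it returns the next node. -/
def Strategy (V : Type u) := List V → V → V

/-- A strategy for player `i` is valid if at every node owned by player `i` it chooses
an outgoing edge. -/
def ValidStrategy (G : ParityGame V) (i : Fin 2) (σ : Strategy V) : Prop :=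
  ∀ (h : List V) (u : V), u ∈ G.nodes → G.owner u = i → G.edge u (σ h u)

/-- The play `f` is consistent with the strategy `σ` of player `i`. -/
def Consistent (G : ParityGame V) (i : Fin 2) (σ : Strategy V) (f : ℕ → V) : Prop :=
  ∀ n, G.owner (f n) = i → f (n + 1) = σ (List.ofFn fun k : Fin n => f k.1) (f n)

/-- `P` holds infinitely often. -/
def InfOften (P : ℕ → Prop) : Prop := ∀ N, ∃ n, N ≤ n ∧ P n

/-- Player `i` wins the play `f` if the largest priority occurring infinitely often
on `f` has parity `i`. -/
def WinsPlay (G : ParityGame V) (i : Fin 2) (f : ℕ → V) : Prop :=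
  ∃ q, InfOften (fun n => G.priority (f n) = q) ∧
    (∀ q', InfOften (fun n => G.priority (f n) = q') → q' ≤ q) ∧ q % 2 = i.1

/-- Player `i` has a winning strategy from node `v`. -/
def WinsFrom (G : ParityGame V) (i : Fin 2) (v : V) : Prop :=
  ∃ σ : Strategy V, ValidStrategy G i σ ∧
    ∀ f : ℕ → V, f 0 = v → IsPlay G f → Consistent G i σ f → WinsPlay G i f

/-- The winning set of player `i`. -/
def winSet (G : ParityGame V) (i : Fin 2) : Set V := {v | v ∈ G.nodes ∧ WinsFrom G i v}

/-- A set `B` of nodes is `i`-closed: player `i` can stay inside `B` and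
player `¬i` cannot leave `B`. -/
def IClosed (G : ParityGame V) (i : Fin 2) (B : Set V) : Prop :=
  B ⊆ G.nodes ∧ ∀ u ∈ B,
    (G.owner u = i → ∃ w, G.edge u w ∧ w ∈ B) ∧
    (G.owner u = other i → ∀ w, G.edge u w → w ∈ B)

/-- The `i`-reachability set of `A`: the set `A` together with all nodes from which
player `i` has a strategy guaranteeing that the play enters `A` at least once. -/
def reach (G : ParityGame V) (i : Fin 2) (A : Set V) : Set V :=
  A ∪ {v | v ∈ G.nodes ∧ ∃ σ : Strategy V, ValidStrategy G i σ ∧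
        ∀ f : ℕ → V, f 0 = v → IsPlay G f → Consistent G i σ f → ∃ n, f n ∈ A}

/-- An `i`-dominion: a set of nodes from each of which player `i` can win
without the play ever leaving the set. -/
def IsDominion (G : ParityGame V) (i : Fin 2) (D : Set V) : Prop :=
  D ⊆ G.nodes ∧ ∃ σ : Strategy V, ValidStrategy G i σ ∧
    ∀ v ∈ D, ∀ f : ℕ → V, f 0 = v → IsPlay G f → Consistent G i σ f →
      WinsPlay G i f ∧ ∀ n, f n ∈ D

/-- The sub-game `G − B` obtained by removing the nodes of `B`. -/
def sub (G : ParityGame V) (B : Set V) : ParityGame V where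
  nodes := G.nodes \ B
  finite := G.finite.subset Set.diff_subset
  owner := G.owner
  edge u v := G.edge u v ∧ u ∉ B ∧ v ∉ B
  edge_mem := fun u v h =>
    ⟨⟨(G.edge_mem u v h.1).1, h.2.1⟩, ⟨(G.edge_mem u v h.1).2, h.2.2⟩⟩
  priority := G.priority

/-- The signed priority `p₁`: `p(v)` if `p(v)` is odd, `−p(v)` if `p(v)` is even. -/
def p1 (G : ParityGame V) (v : V) : ℤ :=
  if G.priority v % 2 = 1 then (G.priority v : ℤ) else -(G.priority v : ℤ)

end ParityGame
namespace ParityGame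

variable {V : Type u}

theorem InfOften.mono {P Q : ℕ → Prop} (h : InfOften P) (hPQ : ∀ n, P n → Q n) : InfOften Q :=
  fun N => (h N).imp fun n hn => ⟨hn.1, hPQ n hn.2⟩

theorem InfOften.or {P Q : ℕ → Prop} (h : InfOften fun n => P n ∨ Q n) :
    InfOften P ∨ InfOften Q := by
  by_contra! hc
  simp only [InfOften, not_forall, not_exists, not_and] at hc
  obtain ⟨⟨M, hM⟩, N, hN⟩ := hc
  obtain ⟨n, hn, hP | hQ⟩ := h (max M N)
  · exact hM n ((le_max_left _ _).trans hn) hP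
  · exact hN n ((le_max_right _ _).trans hn) hQ

/-- If the play `f` arises from a play `g` won by player `i` by replacing some priorities `t` by a
priority `s` which is at least as good for `i`, then `i` wins `f`. -/
theorem WinsPlay.of_replace {G H : ParityGame V} {i : Fin 2} {f g : ℕ → V} {s t : ℕ}
    (hg : H.WinsPlay i g)
    (hfg : ∀ n, G.priority (f n) = H.priority (g n) ∨
      G.priority (f n) = s ∧ H.priority (g n) = t)
    (hts : t < s → s % 2 = i.1) (hst : s < t → t % 2 ≠ i.1) : G.WinsPlay i f := by
  obtain ⟨q, hq, hmax, hpar⟩ := hg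
  have hf : ∀ q', InfOften (fun n => G.priority (f n) = q') →
      InfOften (fun n => H.priority (g n) = q') ∨
        q' = s ∧ InfOften (fun n => H.priority (g n) = t) := by
    intro q' h
    have h' : InfOften fun n => H.priority (g n) = q' ∨ (q' = s ∧ H.priority (g n) = t) :=
      h.mono fun n hn => by have := hfg n; omega
    refine h'.or.imp id fun h'' => ⟨?_, h''.mono fun n hn => hn.2⟩
    obtain ⟨n, -, hn⟩ := h'' 0
    exact hn.1
  by_cases hs : InfOften (fun n => G.priority (f n) = s) ∧ q < s
  · obtain ⟨hs, hqs⟩ := hs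
    refine ⟨s, hs, fun q' hq' => ?_, hts ?_⟩
    · rcases hf q' hq' with h | h
      · exact (hmax q' h).trans hqs.le
      · exact h.1.le
    · rcases hf s hs with h | h
      · exact absurd (hmax s h) hqs.not_ge
      · exact (hmax t h.2).trans_lt hqs
  · refine ⟨q, ?_, fun q' hq' => ?_, hpar⟩
    · have h' : InfOften fun n => G.priority (f n) = q ∨ (q = t ∧ G.priority (f n) = s) :=
        hq.mono fun n hn => by have := hfg n; omega
      rcases h'.or with h | h
      · exact h
      · obtain ⟨n, -, hqt, -⟩ := h 0
        have hs' : InfOften fun n => G.priority (f n) = s := h.mono fun n hn => hn.2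
        have hsq : s ≤ q := not_lt.1 fun hlt => hs ⟨hs', hlt⟩
        have hnlt : ¬ s < t := fun hlt => hst hlt (hqt ▸ hpar)
        obtain rfl : s = q := by omega
        exact hs'
    · rcases hf q' hq' with h | ⟨rfl, -⟩
      · exact hmax q' h
      · exact not_lt.1 fun hlt => hs ⟨hq', hlt⟩

/-- A rule choosing the next node from the first `n + 1` nodes of a play gives rise to a
strategy. -/
theorem winsFrom_of_rule {G : ParityGame V} {i : Fin 2} {x : V} (R : (ℕ → V) → ℕ → V)
    (hloc : ∀ f g n, (∀ k ≤ n, f k = g k) → R f n = R g n)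
    (hvalid : ∀ f n, f n ∈ G.nodes → G.owner (f n) = i → G.edge (f n) (R f n))
    (hwin : ∀ f, f 0 = x → G.IsPlay f → (∀ n, G.owner (f n) = i → f (n + 1) = R f n) →
      G.WinsPlay i f) : G.WinsFrom i x := by
  refine ⟨fun h y => R (fun n => h.getD n y) h.length, fun h y hy ho => ?_,
    fun f hf hplay hcons => hwin f hf hplay fun n hn => ?_⟩
  · have hlast : h.getD h.length y = y := by simp
    have := hvalid (fun n => h.getD n y) h.length
    simp only [hlast] at this
    exact this hy ho
  · rw [hcons n hn]
    simp only [List.length_ofFn]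
    refine hloc _ _ _ fun k hk => ?_
    rcases hk.lt_or_eq with hk | rfl
    · simp [List.getD_eq_getElem?_getD, hk]
    · simp

theorem IsPlay.mem_nodes {G : ParityGame V} {f : ℕ → V} (hf : G.IsPlay f) (n : ℕ) :
    f n ∈ G.nodes := (G.edge_mem _ _ (hf n)).1

open Classical in
/-- The play `f` with `v` in place of `u` wherever `u` was entered from a predecessor of `v`. -/
noncomputable def redirect (G : ParityGame V) (u v : V) (f : ℕ → V) : ℕ → V
  | 0 => f 0
  | n + 1 => if f (n + 1) = u ∧ G.edge (f n) v then v else f (n + 1)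

open Classical in
/-- The history and the current node after `n` steps of the play `f`, with `u` in place of `v`
wherever the strategy `σ` prescribes `u`. -/
noncomputable def unredirect (σ : Strategy V) (u v : V) (f : ℕ → V) : ℕ → List V × V
  | 0 => ([], f 0)
  | n + 1 =>
    ((unredirect σ u v f n).1 ++ [(unredirect σ u v f n).2],
      if f (n + 1) = v ∧ σ (unredirect σ u v f n).1 (unredirect σ u v f n).2 = u then u
      else f (n + 1))

theorem redirect_eq_or (G : ParityGame V) (u v : V) (f : ℕ → V) (n : ℕ) :
    G.redirect u v f n = f n ∨ f n = u ∧ G.redirect u v f n = v := by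
  cases n with
  | zero => exact .inl rfl
  | succ n =>
    rw [redirect]
    split_ifs with h
    · exact .inr ⟨h.1, rfl⟩
    · exact .inl rfl

theorem redirect_congr (G : ParityGame V) (u v : V) {f g : ℕ → V} {n : ℕ}
    (h : ∀ k ≤ n, f k = g k) : G.redirect u v f n = G.redirect u v g n := by
  cases n with
  | zero => exact h 0 le_rfl
  | succ n => rw [redirect, redirect, h (n + 1) le_rfl, h n n.le_succ]

theorem unredirect_eq_or (σ : Strategy V) (u v : V) (f : ℕ → V) (n : ℕ) :
    (unredirect σ u v f n).2 = f n ∨ f n = v ∧ (unredirect σ u v f n).2 = u := by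
  cases n with
  | zero => exact .inl rfl
  | succ n =>
    simp only [unredirect]
    split_ifs with h
    · exact .inr ⟨h.1, rfl⟩
    · exact .inl rfl

theorem unredirect_congr (σ : Strategy V) (u v : V) {f g : ℕ → V} {n : ℕ}
    (h : ∀ k ≤ n, f k = g k) : unredirect σ u v f n = unredirect σ u v g n := by
  induction n with
  | zero => simp only [unredirect, h 0 le_rfl]
  | succ n ih =>
    rw [unredirect, unredirect, h (n + 1) le_rfl, ih fun k hk => h k (hk.trans n.le_succ)]

theorem unredirect_fst (σ : Strategy V) (u v : V) (f : ℕ → V) (n : ℕ) :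
    (unredirect σ u v f n).1 = List.ofFn fun k : Fin n => (unredirect σ u v f k.1).2 := by
  induction n with
  | zero => simp [unredirect]
  | succ n ih =>
    rw [List.ofFn_succ', unredirect, ih]
    simp

theorem priority_mod_two_of_p1_le {G : ParityGame V} {u v : V} (h : G.p1 u ≤ G.p1 v) :
    (G.priority v < G.priority u → G.priority u % 2 = 0) ∧
      (G.priority u < G.priority v → G.priority v % 2 = 1) := by
  unfold p1 at h
  split_ifs at h <;> omega

section EdgeDeletion

variable {G G' : ParityGame V} {u v x : V}

theorem WinsFrom.zero_deletion (hbip : G.Bipartite) (hou : G.owner u = 0)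
    (hnodes : G'.nodes = G.nodes) (howner : G'.owner = G.owner)
    (hprio : G'.priority = G.priority)
    (hedge : ∀ a b, G'.edge a b ↔ (G.edge a b ∧ ¬(b = u ∧ G.edge a v)))
    (h : G.WinsFrom 0 x) : G'.WinsFrom 0 x := by
  obtain ⟨σ, hσ, hwin⟩ := h
  refine ⟨σ, fun h y hy ho => ?_, fun f hf hplay hcons => ?_⟩
  · rw [hnodes] at hy
    rw [howner] at ho
    refine (hedge _ _).2 ⟨hσ h y hy ho, fun hyu => hbip _ _ (hσ h y hy ho) ?_⟩
    rw [ho, hyu.1, hou]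
  · have := hwin f hf (fun n => ((hedge _ _).1 (hplay n)).1) (by rwa [Consistent, ← howner])
    rwa [WinsPlay, hprio]

theorem WinsFrom.one_of_deletion (hbip : G.Bipartite) (hou : G.owner u = 0)
    (hnodes : G'.nodes = G.nodes) (howner : G'.owner = G.owner)
    (hprio : G'.priority = G.priority)
    (hedge : ∀ a b, G'.edge a b ↔ (G.edge a b ∧ ¬(b = u ∧ G.edge a v)))
    (h : G'.WinsFrom 1 x) : G.WinsFrom 1 x := by
  obtain ⟨σ, hσ, hwin⟩ := h
  rw [ValidStrategy, hnodes, howner] at hσ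
  refine ⟨σ, fun h y hy ho => ((hedge _ _).1 (hσ h y hy ho)).1, fun f hf hplay hcons => ?_⟩
  have hplay' : G'.IsPlay f := by
    intro n
    by_cases ho : G.owner (f n) = 1
    · rw [hcons n ho]
      exact hσ _ _ (hplay.mem_nodes n) ho
    · refine (hedge _ _).2 ⟨hplay n, fun hfu => hbip _ _ (hplay n) ?_⟩
      rw [hfu.1, hou]
      omega
  have := hwin f hf hplay' (by rwa [Consistent, howner])
  rwa [WinsPlay, ← hprio]

theorem WinsFrom.zero_of_deletion (hbip : G.Bipartite) (hv : v ∈ G.nodes) (huv : u ≠ v)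
    (hou : G.owner u = 0) (hov : G.owner v = 0) (hsub : ∀ w, G.edge v w → G.edge u w)
    (hp : G.p1 u ≤ G.p1 v) (hnodes : G'.nodes = G.nodes) (howner : G'.owner = G.owner)
    (hprio : G'.priority = G.priority)
    (hedge : ∀ a b, G'.edge a b ↔ (G.edge a b ∧ ¬(b = u ∧ G.edge a v)))
    (h : G'.WinsFrom 0 x) : G.WinsFrom 0 x := by
  obtain ⟨σ, hσ, hwin⟩ := h
  rw [ValidStrategy, hnodes, howner] at hσ
  have hmove : ∀ f n, f n ∈ G.nodes → G.owner (f n) = 0 →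
      ∀ h, G'.edge (G.redirect u v f n) (σ h (G.redirect u v f n)) := by
    intro f n hn ho h
    rcases G.redirect_eq_or u v f n with h' | ⟨-, h'⟩
    · rw [h']
      exact hσ _ _ hn ho
    · rw [h']
      exact hσ _ _ hv hov
  refine winsFrom_of_rule
    (fun f n => σ (List.ofFn fun k : Fin n => G.redirect u v f k.1) (G.redirect u v f n))
    (fun f g n hfg => ?_) (fun f n hn ho => ?_) (fun f hf hplay hcons => ?_)
  · have : (fun k : Fin n => G.redirect u v f k.1) = fun k : Fin n => G.redirect u v g k.1 :=
      funext fun k => G.redirect_congr u v fun j hj => hfg j (hj.trans k.2.le)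
    simp only [this, G.redirect_congr u v hfg]
  · have hm := ((hedge _ _).1 (hmove f n hn ho
      (List.ofFn fun k : Fin n => G.redirect u v f k.1))).1
    rcases G.redirect_eq_or u v f n with h' | ⟨hu', h'⟩
    · rwa [h'] at hm ⊢
    · rw [h'] at hm ⊢
      rw [hu']
      exact hsub _ hm
  · have howner_redirect : ∀ n, G.owner (G.redirect u v f n) = G.owner (f n) := by
      intro n
      rcases G.redirect_eq_or u v f n with h' | ⟨hu', h'⟩
      · rw [h']
      · rw [h', hu', hou, hov]
    have hsucc : ∀ n, G.owner (f n) = 0 → G.redirect u v f (n + 1) = f (n + 1) := by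
      intro n ho
      refine (G.redirect_eq_or u v f (n + 1)).resolve_right fun h' => hbip _ _ (hplay n) ?_
      rw [ho, h'.1, hou]
    have hcons' : G'.Consistent 0 σ (G.redirect u v f) := by
      intro n ho
      rw [howner, howner_redirect] at ho
      rw [hsucc n ho, hcons n ho]
    have hplay' : G'.IsPlay (G.redirect u v f) := by
      intro n
      by_cases ho : G.owner (f n) = 0
      · rw [hcons' n (by rw [howner, howner_redirect, ho])]
        exact hmove f n (hplay.mem_nodes n) ho _
      · have hn : G.redirect u v f n = f n :=
          (G.redirect_eq_or u v f n).resolve_right fun h' => ho (h'.1 ▸ hou)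
        rw [hn, redirect, hedge]
        split_ifs with h'
        · exact ⟨h'.2, fun h => huv h.1.symm⟩
        · exact ⟨hplay n, h'⟩
    refine (hwin (G.redirect u v f) hf hplay' hcons').of_replace (s := G.priority u) (t := G.priority v)
      (fun n => ?_) (priority_mod_two_of_p1_le hp).1 fun h => by simp [(priority_mod_two_of_p1_le hp).2 h]
    rw [hprio]
    rcases G.redirect_eq_or u v f n with h' | ⟨hu', h'⟩
    · exact .inl (by rw [h'])
    · exact .inr ⟨by rw [hu'], by rw [h']⟩

open Classical in
theorem WinsFrom.one_deletion (hbip : G.Bipartite) (huv : u ≠ v)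
    (hou : G.owner u = 0) (hov : G.owner v = 0) (hsub : ∀ w, G.edge v w → G.edge u w)
    (hp : G.p1 u ≤ G.p1 v) (hnodes : G'.nodes = G.nodes) (howner : G'.owner = G.owner)
    (hprio : G'.priority = G.priority)
    (hedge : ∀ a b, G'.edge a b ↔ (G.edge a b ∧ ¬(b = u ∧ G.edge a v)))
    (h : G.WinsFrom 1 x) : G'.WinsFrom 1 x := by
  obtain ⟨σ, hσ, hwin⟩ := h
  let next (f : ℕ → V) (n : ℕ) : V := σ (unredirect σ u v f n).1 (unredirect σ u v f n).2
  have hcur : ∀ f n, G.owner (f n) = 1 → (unredirect σ u v f n).2 = f n := fun f n ho =>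
    (unredirect_eq_or σ u v f n).resolve_right fun h' => by simp [h'.1, hov] at ho
  have hmove : ∀ f n, f n ∈ G.nodes → G.owner (f n) = 1 → G.edge (f n) (next f n) := by
    intro f n hn ho
    simp only [next, hcur f n ho]
    exact hσ _ _ hn ho
  refine winsFrom_of_rule
    (fun f n => if next f n = u ∧ G.edge (f n) v then v else next f n)
    (fun f g n hfg => ?_) (fun f n hn ho => ?_) (fun f hf hplay hcons => ?_)
  · simp only [next, unredirect_congr σ u v hfg, hfg n le_rfl]
  · rw [hnodes] at hn
    rw [howner] at ho
    rw [hedge]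
    split_ifs with h'
    · exact ⟨h'.2, fun h => huv h.1.symm⟩
    · exact ⟨hmove f n hn ho, h'⟩
  · rw [howner] at hcons
    have hplayG : G.IsPlay f := fun n => ((hedge _ _).1 (hplay n)).1
    have hnext : ∀ n, G.owner (f n) = 1 → (unredirect σ u v f (n + 1)).2 = next f n := by
      intro n ho
      have hc := hcons n ho
      change (if f (n + 1) = v ∧ next f n = u then u else f (n + 1)) = next f n
      grind
    have howner' : ∀ n, G.owner (unredirect σ u v f n).2 = G.owner (f n) := by
      intro n
      rcases unredirect_eq_or σ u v f n with h' | ⟨hv', h'⟩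
      · rw [h']
      · rw [h', hv', hou, hov]
    have hcons' : G.Consistent 1 σ fun n => (unredirect σ u v f n).2 := by
      intro n ho
      rw [howner'] at ho
      simp only [hnext n ho, ← unredirect_fst, next]
    have hplay' : G.IsPlay fun n => (unredirect σ u v f n).2 := by
      intro n
      beta_reduce
      by_cases ho : G.owner (f n) = 1
      · rw [hnext n ho, hcur f n ho]
        exact hmove f n (hplayG.mem_nodes n) ho
      · have hsucc : (unredirect σ u v f (n + 1)).2 = f (n + 1) := by
          refine (unredirect_eq_or σ u v f (n + 1)).resolve_right fun h' =>
            hbip _ _ (hplayG n) ?_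
          rw [h'.1, hov]
          omega
        rw [hsucc]
        rcases unredirect_eq_or σ u v f n with h' | ⟨hv', h'⟩
        · rw [h']
          exact hplayG n
        · rw [h']
          exact hsub _ (hv' ▸ hplayG n)
    refine (hwin (fun n => (unredirect σ u v f n).2) hf hplay' hcons').of_replace
      (s := G.priority v) (t := G.priority u)
      (fun n => ?_) (priority_mod_two_of_p1_le hp).2 fun h => by simp [(priority_mod_two_of_p1_le hp).1 h]
    rw [hprio]
    rcases unredirect_eq_or σ u v f n with h' | ⟨hv', h'⟩
    · exact .inl (by rw [h'])
    · exact .inr ⟨by rw [hv'], by rw [h']⟩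

end EdgeDeletion

end ParityGame

/-- In a bipartite parity game, if `u, v ∈ V₀` are distinct with
`N⁺(v) ⊆ N⁺(u)` and `p₁(v) ≥ p₁(u)`, then deleting the edges
`{(w,u) ∈ E : (w,v) ∈ E}` leaves both winning sets unchanged. -/
theorem edge_deletion {V : Type} (G G' : ParityGame V) (hG : G.Proper) (hbip : G.Bipartite)
    (u v : V) (hu : u ∈ G.nodes) (hv : v ∈ G.nodes) (huv : u ≠ v)
    (hou : G.owner u = 0) (hov : G.owner v = 0)
    (hsub : ∀ w, G.edge v w → G.edge u w)
    (hp : G.p1 u ≤ G.p1 v)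
    (hnodes : G'.nodes = G.nodes) (howner : G'.owner = G.owner)
    (hprio : G'.priority = G.priority)
    (hedge : ∀ a b, G'.edge a b ↔ (G.edge a b ∧ ¬(b = u ∧ G.edge a v))) :
    ∀ i : Fin 2, G'.winSet i = G.winSet i := by 
  intro i
  ext x
  simp only [ParityGame.winSet, Set.mem_ofPred_eq, hnodes]
  refine and_congr_right fun _ => ?_
  fin_cases i
  · exact ⟨.zero_of_deletion hbip hv huv hou hov hsub hp hnodes howner hprio hedge,
      .zero_deletion hbip hou hnodes howner hprio hedge⟩
  · exact ⟨.one_of_deletion hbip hou hnodes howner hprio hedge,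
      .one_deletion hbip huv hou hov hsub hp hnodes howner hprio hedge⟩
end

section
/- Let D ≥ 0 be a real number and let T : ℕ → ℝ be such that T(k) ≥ 0 for all k; T(k) ≤ D whenever k ≤ 4; and for all k ≥ 5, T(k) ≤ T(k − 1) + 2·T(k − ⌈√(2k)⌉) + D. Then T(k) ≤ 2(2k)^{⌊√(2k)⌋} · D for all k ∈ ℕ. -/
universe u

theorem Nat.sqrt_two_mul_sub_lt {k c : ℕ} (hk : 0 < k) (hc : 2 * k ≤ c ^ 2) :
    Nat.sqrt (2 * (k - c)) < Nat.sqrt (2 * k) := by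
  rw [Nat.sqrt_lt']
  have h := Nat.lt_succ_sqrt' (2 * k)
  have hs : 0 < Nat.sqrt (2 * k) := Nat.sqrt_pos.mpr (by lia)
  rw [Nat.succ_eq_add_one] at h
  generalize Nat.sqrt (2 * k) = s at *
  rcases le_total k c with hkc | hkc
  · rw [Nat.sub_eq_zero_of_le hkc]
    positivity
  · rcases le_or_gt c s with hcs | hcs
    · have : c ^ 2 ≤ s ^ 2 := Nat.pow_le_pow_left hcs 2
      have : 0 < c := by
        by_contra! h0
        obtain rfl : c = 0 := by lia
        lia
      lia
    · have : (s + 1) ^ 2 = s ^ 2 + 2 * s + 1 := by ring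
      lia

theorem two_mul_pow_sqrt_recurrence {k c : ℕ} (hk : 5 ≤ k) (hc : 2 * k ≤ c ^ 2) :
    2 * (2 * (k - 1)) ^ Nat.sqrt (2 * (k - 1)) +
        2 * (2 * (2 * (k - c)) ^ Nat.sqrt (2 * (k - c))) + 1 ≤
      2 * (2 * k) ^ Nat.sqrt (2 * k) := by
  have hlt := Nat.sqrt_two_mul_sub_lt (by lia) hc
  have hmono : Nat.sqrt (2 * (k - 1)) ≤ Nat.sqrt (2 * k) := Nat.sqrt_le_sqrt (by lia)
  have h3 : 3 ≤ Nat.sqrt (2 * k) := by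
    rw [Nat.le_sqrt]
    lia
  have hc1 : 1 ≤ c := by
    by_contra! h0
    obtain rfl : c = 0 := by lia
    lia
  obtain ⟨s, hs⟩ : ∃ s, Nat.sqrt (2 * k) = s + 1 := ⟨Nat.sqrt (2 * k) - 1, by lia⟩
  rw [hs] at hlt hmono h3 ⊢
  obtain ⟨m, rfl⟩ : ∃ m, k = m + 1 := ⟨k - 1, by lia⟩
  rw [Nat.add_sub_cancel] at hmono ⊢
  have h₁ : (2 * m) ^ Nat.sqrt (2 * m) ≤ (2 * m) ^ (s + 1) :=
    Nat.pow_le_pow_right (by lia) hmono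
  have h₂ : (2 * (m + 1 - c)) ^ Nat.sqrt (2 * (m + 1 - c)) ≤ (2 * m) ^ s :=
    (Nat.pow_le_pow_left (by lia) _).trans (Nat.pow_le_pow_right (by lia) (by lia))
  have h₃ : (2 * m) ^ s < (2 * (m + 1)) ^ s := Nat.pow_lt_pow_left (by lia) (by lia)
  have h₄ : m * (2 * m) ^ s ≤ m * (2 * (m + 1)) ^ s := Nat.mul_le_mul_left m h₃.le
  have h₅ : (2 * m) ^ (s + 1) = 2 * (m * (2 * m) ^ s) := by ring
  have h₆ : (2 * (m + 1)) ^ (s + 1) =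
      2 * (m * (2 * (m + 1)) ^ s) + 2 * (2 * (m + 1)) ^ s := by ring
  lia

theorem toNat_floor_sqrt_two_mul (k : ℕ) :
    (⌊Real.sqrt (2 * (k : ℝ))⌋).toNat = Nat.sqrt (2 * k) := by
  have h := Real.floor_real_sqrt_eq_nat_sqrt (a := 2 * k)
  push_cast at h
  rw [h, Int.toNat_natCast]

theorem two_mul_le_sq_toNat_ceil_sqrt (k : ℕ) :
    2 * k ≤ (⌈Real.sqrt (2 * (k : ℝ))⌉).toNat ^ 2 := by
  have h : Real.sqrt (2 * (k : ℝ)) ≤ ((⌈Real.sqrt (2 * (k : ℝ))⌉).toNat : ℝ) := by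
    rw [Int.ceil_toNat]
    exact Nat.le_ceil _
  exact_mod_cast (Real.sqrt_le_left (Nat.cast_nonneg _)).mp h

/-- The recurrence governing `new-win₁` on bipartite parity games:
if `T(k) ≤ D` for `k ≤ 4` and `T(k) ≤ T(k−1) + 2·T(k−⌈√(2k)⌉) + D` for `k ≥ 5`,
then `T(k) ≤ 2(2k)^{⌊√(2k)⌋}·D` for all `k`. -/
theorem recurrence_bipartite (D : ℝ) (hD : 0 ≤ D) (T : ℕ → ℝ)
    (hpos : ∀ k, 0 ≤ T k)
    (hbase : ∀ k, k ≤ 4 → T k ≤ D)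
    (hrec : ∀ k, 5 ≤ k →
      T k ≤ T (k - 1) + 2 * T (k - (⌈Real.sqrt (2 * (k : ℝ))⌉).toNat) + D) :
    ∀ k, T k ≤ 2 * (((2 * k) ^ (⌊Real.sqrt (2 * (k : ℝ))⌋).toNat : ℕ) : ℝ) * D := by
  intro k
  induction k using Nat.strong_induction_on with
  | _ k ih =>
    rcases Nat.lt_or_ge k 5 with hk | hk
    · have hpow : 1 ≤ (2 * k) ^ (⌊Real.sqrt (2 * (k : ℝ))⌋).toNat := by
        rcases Nat.eq_zero_or_pos k with rfl | hk0
        · simp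
        · exact Nat.one_le_pow _ _ (by lia)
      have hcast : (1 : ℝ) ≤ (((2 * k) ^ (⌊Real.sqrt (2 * (k : ℝ))⌋).toNat : ℕ) : ℝ) := by
        exact_mod_cast hpow
      nlinarith [hbase k (by lia)]
    · have hc := two_mul_le_sq_toNat_ceil_sqrt k
      have hr := hrec k hk
      generalize (⌈Real.sqrt (2 * (k : ℝ))⌉).toNat = c at hc hr
      have hc1 : 1 ≤ c := by
        by_contra! h0
        obtain rfl : c = 0 := by lia
        lia
      have h₁ := ih (k - 1) (by lia)
      have h₂ := ih (k - c) (by lia)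
      rw [toNat_floor_sqrt_two_mul] at h₁ h₂ ⊢
      have key : (2 * (((2 * (k - 1)) ^ Nat.sqrt (2 * (k - 1)) : ℕ) : ℝ) +
          2 * (2 * (((2 * (k - c)) ^ Nat.sqrt (2 * (k - c)) : ℕ) : ℝ)) + 1) ≤
          2 * (((2 * k) ^ Nat.sqrt (2 * k) : ℕ) : ℝ) := by
        exact_mod_cast two_mul_pow_sqrt_recurrence hk hc
      linarith [mul_le_mul_of_nonneg_right key hD]
end
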